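/- Let P be a finite bounded graded poset and let κ be a P-kernel. Then there exists a unique family g = (g_{xy})_{x≤y∈P} of polynomials in ℤ[t] (the left Kazhdan–Lusztig–Stanley polynomials of κ) such that: (i) g_{xx}(t) = 1 for all x ∈ P; (ii) deg g_{xy} < rk[x,y]/2 for all x < y; and (iii) for all x < z, t^{rk[x,z]}·g_{xz}(1/t) = Σ_{x≤y≤z} g_{xy}(t)·κ_{yz}(t) in ℤ[t]. -/

import Mathlib

open Polynomial Finset in
theorem Polynomial.two_mul_degree_lt_iff {R : Type*} [Semiring R] {p : R[X]} {d : ℕ} :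
    2 * p.degree < (d : WithBot ℕ) ↔ ∀ i, d ≤ 2 * i → p.coeff i = 0 := by
  by_cases hp : p = 0
  · subst hp
    have h : (2 : WithBot ℕ) * ⊥ = ⊥ := WithBot.mul_bot (by norm_num)
    simp [h]
  · rw [degree_eq_natDegree hp]
    have h : (2 * (p.natDegree : WithBot ℕ) < (d : WithBot ℕ)) ↔ 2 * p.natDegree < d := by
      norm_cast
    rw [h]
    constructor
    · intro h i hi
      exact coeff_eq_zero_of_natDegree_lt (by omega)
    · intro h
      by_contra! hlt
      exact hp (leadingCoeff_eq_zero.mp (h _ hlt))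

open Polynomial in
/-- A polynomial of degree less than `d / 2` is determined by the difference between its
`d`-reversal and itself. -/
theorem Polynomial.eq_of_reflect_sub_self_eq {R : Type*} [Ring R] {p q : R[X]} {d : ℕ}
    (hp : ∀ i, d ≤ 2 * i → p.coeff i = 0) (hq : ∀ i, d ≤ 2 * i → q.coeff i = 0)
    (h : reflect d p - p = reflect d q - q) : p = q := by
  ext i
  by_cases hi : d ≤ 2 * i
  · rw [hp i hi, hq i hi]
  · have hc := congrArg (fun r => coeff r i) h
    simp only [coeff_sub, coeff_reflect, revAt_le (show i ≤ d by omega)] at hc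
    rw [hp (d - i) (by omega), hq (d - i) (by omega)] at hc
    simpa using hc

open Polynomial in
/-- The negated lower half of `q`: the coefficients of `-q` in degrees less than `d / 2`. -/
noncomputable def Polynomial.negLowerHalf {R : Type*} [Ring R] (d : ℕ) (q : R[X]) : R[X] :=
  ∑ i ∈ Finset.range ((d + 1) / 2), monomial i (-q.coeff i)

open Polynomial in
theorem Polynomial.coeff_negLowerHalf {R : Type*} [Ring R] (d : ℕ) (q : R[X]) (i : ℕ) :
    (negLowerHalf d q).coeff i = if 2 * i < d then -q.coeff i else 0 := by
  have h : i < (d + 1) / 2 ↔ 2 * i < d := by omega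
  simp only [negLowerHalf, finsetSum_coeff, coeff_monomial, Finset.sum_ite_eq', Finset.mem_range, h]

open Polynomial in
theorem Polynomial.reflect_negLowerHalf {d : ℕ} {q : ℤ[X]} (hdeg : q.natDegree ≤ d)
    (hq : reflect d q = -q) : reflect d (negLowerHalf d q) = negLowerHalf d q + q := by
  ext i
  rw [coeff_add, coeff_reflect, coeff_negLowerHalf, coeff_negLowerHalf]
  by_cases hi : i ≤ d
  · have hc := congrArg (fun r => coeff r i) hq
    simp only [coeff_reflect, revAt_le hi, coeff_neg] at hc
    rw [revAt_le hi]
    rcases lt_trichotomy (2 * i) d with h | h | h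
    · rw [if_neg (by omega), if_pos h]; simp
    · rw [show d - i = i by omega] at hc ⊢
      rw [if_neg (by omega)]; omega
    · rw [if_pos (by omega), if_neg (by omega)]; omega
  · rw [revAt_eq_self_of_lt (by omega), if_neg (by omega),
      coeff_eq_zero_of_natDegree_lt (by omega : q.natDegree < i), add_zero]

open Polynomial in
theorem Polynomial.reflect_sum {R ι : Type*} [Semiring R] (d : ℕ) (s : Finset ι) (p : ι → R[X]) :
    reflect d (∑ i ∈ s, p i) = ∑ i ∈ s, reflect d (p i) := by
  ext i
  simp [coeff_reflect]

section KLS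

open Polynomial Finset

variable {P : Type*} [PartialOrder P] [LocallyFiniteOrder P]

/-- The left Kazhdan–Lusztig–Stanley polynomials of `κ` with first index `x`, constructed by
recursion on the second index. -/
noncomputable def leftKLS [WellFoundedLT P] (rk : P → ℕ) (κ : P → P → ℤ[X]) (x : P) : P → ℤ[X] :=
  open Classical in
  wellFounded_lt.fix fun z f =>
    if x = z then 1
    else negLowerHalf (rk z - rk x)
      (∑ y ∈ (Ico x z).attach, f y.1 (mem_Ico.mp y.2).2 * κ y.1 z)

theorem leftKLS_self [WellFoundedLT P] (rk : P → ℕ) (κ : P → P → ℤ[X]) (x : P) :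
    leftKLS rk κ x x = 1 := by
  rw [leftKLS, WellFounded.fix_eq, if_pos rfl]

theorem leftKLS_of_lt [WellFoundedLT P] (rk : P → ℕ) (κ : P → P → ℤ[X]) {x z : P} (h : x < z) :
    leftKLS rk κ x z =
      negLowerHalf (rk z - rk x) (∑ y ∈ Ico x z, leftKLS rk κ x y * κ y z) := by
  rw [leftKLS, WellFounded.fix_eq, if_neg h.ne]
  congr 1
  exact sum_attach (Ico x z) fun y => leftKLS rk κ x y * κ y z

variable {rk : P → ℕ} {κ : P → P → ℤ[X]}

/-- The reversal of a kernel is also its right inverse. -/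
theorem kernel_mul_reflect (hrk : StrictMono rk)
    (hκ_deg : ∀ x y : P, x ≤ y → (κ x y).natDegree ≤ rk y - rk x)
    (hκ_ker : ∀ x z : P, x < z →
      ∑ y ∈ Icc x z, reflect (rk y - rk x) (κ x y) * κ y z = 0) {x z : P} (h : x < z) :
    ∑ y ∈ Icc x z, κ x y * reflect (rk z - rk y) (κ y z) = 0 := by
  have := congrArg (reflect (rk z - rk x)) (hκ_ker x z h)
  rw [reflect_zero, Polynomial.reflect_sum] at this
  rw [← this]
  refine sum_congr rfl fun y hy => ?_
  obtain ⟨hxy, hyz⟩ := mem_Icc.mp hy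
  have h1 := hrk.monotone hxy
  have h2 := hrk.monotone hyz
  rw [show rk z - rk x = (rk y - rk x) + (rk z - rk y) by omega,
    reflect_mul _ _ (natDegree_reflect_le.trans (max_le le_rfl (hκ_deg x y hxy))) (hκ_deg y z hyz),
    Polynomial.reflect_reflect]

/-- If `f` satisfies the defining relation of the left KLS polynomials below `z`, then the partial
sum omitting `z` is negated by reversal. -/
theorem reflect_sum_Ico_mul_kernel (hrk : StrictMono rk)
    (hκ_refl : ∀ x : P, κ x x = 1)
    (hκ_deg : ∀ x y : P, x ≤ y → (κ x y).natDegree ≤ rk y - rk x)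
    (hκ_ker : ∀ x z : P, x < z →
      ∑ y ∈ Icc x z, reflect (rk y - rk x) (κ x y) * κ y z = 0)
    {x z : P} {f : P → ℤ[X]}
    (hf_deg : ∀ y ∈ Ico x z, (f y).natDegree ≤ rk y - rk x)
    (hf : ∀ y ∈ Ico x z, reflect (rk y - rk x) (f y) = ∑ w ∈ Icc x y, f w * κ w y) :
    reflect (rk z - rk x) (∑ y ∈ Ico x z, f y * κ y z) = -∑ y ∈ Ico x z, f y * κ y z := by
  calc reflect (rk z - rk x) (∑ y ∈ Ico x z, f y * κ y z)
      = ∑ y ∈ Ico x z, ∑ w ∈ Icc x y, f w * (κ w y * reflect (rk z - rk y) (κ y z)) := by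
        rw [Polynomial.reflect_sum]
        refine sum_congr rfl fun y hy => ?_
        obtain ⟨hxy, hyz⟩ := mem_Ico.mp hy
        have h1 := hrk.monotone hxy
        have h2 := hrk hyz
        rw [show rk z - rk x = (rk y - rk x) + (rk z - rk y) by omega,
          reflect_mul _ _ (hf_deg y hy) (hκ_deg y z hyz.le), hf y hy, sum_mul]
        simp only [mul_assoc]
    _ = ∑ w ∈ Ico x z, ∑ y ∈ Ico w z, f w * (κ w y * reflect (rk z - rk y) (κ y z)) := by
        refine sum_comm' fun y w => ?_
        simp only [mem_Ico, mem_Icc]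
        exact ⟨fun ⟨⟨_, h2⟩, h3, h4⟩ => ⟨⟨h4, h2⟩, h3, h4.trans_lt h2⟩,
          fun ⟨⟨h1, h2⟩, h3, _⟩ => ⟨⟨h3.trans h1, h2⟩, h3, h1⟩⟩
    _ = -∑ y ∈ Ico x z, f y * κ y z := by
        rw [← sum_neg_distrib]
        refine sum_congr rfl fun w hw => ?_
        obtain ⟨hxw, hwz⟩ := mem_Ico.mp hw
        have := kernel_mul_reflect hrk hκ_deg hκ_ker hwz
        rw [← sum_Ico_add_eq_sum_Icc hwz.le, hκ_refl, Nat.sub_self, reflect_one, pow_zero,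
          mul_one] at this
        rw [← mul_sum, eq_neg_of_add_eq_zero_left this, mul_neg]

theorem coeff_leftKLS_eq_zero [WellFoundedLT P] {x z : P} (h : x < z) {i : ℕ}
    (hi : rk z - rk x ≤ 2 * i) : (leftKLS rk κ x z).coeff i = 0 := by
  rw [leftKLS_of_lt rk κ h, coeff_negLowerHalf, if_neg (by omega)]

theorem natDegree_leftKLS_le [WellFoundedLT P] {x z : P} (h : x ≤ z) :
    (leftKLS rk κ x z).natDegree ≤ rk z - rk x := by
  rcases h.eq_or_lt with rfl | h
  · simp [leftKLS_self]
  · rw [natDegree_le_iff_coeff_eq_zero]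
    exact fun i hi => coeff_leftKLS_eq_zero h (by omega)

theorem reflect_leftKLS [WellFoundedLT P] (hrk : StrictMono rk)
    (hκ_refl : ∀ x : P, κ x x = 1)
    (hκ_deg : ∀ x y : P, x ≤ y → (κ x y).natDegree ≤ rk y - rk x)
    (hκ_ker : ∀ x z : P, x < z →
      ∑ y ∈ Icc x z, reflect (rk y - rk x) (κ x y) * κ y z = 0) (x z : P) (h : x ≤ z) :
    reflect (rk z - rk x) (leftKLS rk κ x z) = ∑ y ∈ Icc x z, leftKLS rk κ x y * κ y z := by
  induction z using WellFoundedLT.induction with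
  | ind z ih =>
  rcases h.eq_or_lt with rfl | hlt
  · simp [leftKLS_self, hκ_refl]
  · rw [← sum_Ico_add_eq_sum_Icc h, hκ_refl, mul_one, leftKLS_of_lt rk κ hlt, add_comm]
    refine reflect_negLowerHalf (natDegree_sum_le_of_forall_le _ _ fun y hy => ?_)
      (reflect_sum_Ico_mul_kernel hrk hκ_refl hκ_deg hκ_ker
        (fun y hy => natDegree_leftKLS_le (mem_Ico.mp hy).1)
        fun y hy => ih y (mem_Ico.mp hy).2 (mem_Ico.mp hy).1)
    obtain ⟨hxy, hyz⟩ := mem_Ico.mp hy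
    have h1 := hrk.monotone hxy
    have h2 := hrk hyz
    have h3 := natDegree_leftKLS_le (rk := rk) (κ := κ) hxy
    have h4 := hκ_deg y z hyz.le
    exact natDegree_mul_le.trans (by omega)

end KLS


/-- **Statement 1.** Let `P` be a finite bounded graded poset and `κ` a `P`-kernel.
There exists a unique family `g = (g_{xy})_{x ≤ y}` of polynomials in `ℤ[t]`
(the left Kazhdan–Lusztig–Stanley polynomials of `κ`) such that:
(i) `f_{xx} = 1`; (ii) `deg f_{xy} < rk[x,y]/2` for `x < y`; and
(iii) `t^{rk[x,z]} f_{xz}(1/t) = ∑_{x ≤ y ≤ z} f_{xy}(t) κ_{yz}(t)` for `x < z`,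
where `t^d f(1/t)` is the `d`-reversal `Polynomial.reflect d f`. -/
theorem exists_unique_left_KLS_polynomials
    {P : Type*} [PartialOrder P] [BoundedOrder P] [Fintype P] [LocallyFiniteOrder P]
    (rk : P → ℕ) (hrk_bot : rk ⊥ = 0)
    (hrk_cov : ∀ x y : P, x ⋖ y → rk y = rk x + 1)
    (κ : P → P → Polynomial ℤ)
    (hκ_refl : ∀ x : P, κ x x = 1)
    (hκ_deg : ∀ x y : P, x ≤ y → (κ x y).natDegree ≤ rk y - rk x)
    (hκ_ker : ∀ x z : P, x < z →
      ∑ y ∈ Finset.Icc x z, Polynomial.reflect (rk y - rk x) (κ x y) * κ y z = 0) :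
    ∃ f : P → P → Polynomial ℤ,
      ((∀ x : P, f x x = 1) ∧
        (∀ x y : P, x < y →
          2 * (f x y).degree < ((rk y - rk x : ℕ) : WithBot ℕ)) ∧
        (∀ x z : P, x < z →
          Polynomial.reflect (rk z - rk x) (f x z)
            = ∑ y ∈ Finset.Icc x z, f x y * κ y z)) ∧
      ∀ g : P → P → Polynomial ℤ,
        ((∀ x : P, g x x = 1) ∧
          (∀ x y : P, x < y →
            2 * (g x y).degree < ((rk y - rk x : ℕ) : WithBot ℕ)) ∧
          (∀ x z : P, x < z →
            Polynomial.reflect (rk z - rk x) (g x z)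
              = ∑ y ∈ Finset.Icc x z, g x y * κ y z)) →
        ∀ x y : P, x ≤ y → g x y = f x y := by
  have hrk : StrictMono rk :=
    (strictMono_iff_forall_covBy rk).mpr fun x y h => by rw [hrk_cov x y h]; omega
  have hrefl := reflect_leftKLS hrk hκ_refl hκ_deg hκ_ker
  refine ⟨leftKLS rk κ, ⟨leftKLS_self rk κ, fun x y h => ?_, fun x z h => hrefl x z h.le⟩, ?_⟩
  · exact Polynomial.two_mul_degree_lt_iff.mpr fun i hi => coeff_leftKLS_eq_zero h hi
  · rintro g ⟨hg_refl, hg_deg, hg⟩ x z hxz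
    induction z using WellFoundedLT.induction with
    | ind z ih =>
    rcases hxz.eq_or_lt with rfl | h
    · rw [hg_refl, leftKLS_self]
    · refine Polynomial.eq_of_reflect_sub_self_eq
        (Polynomial.two_mul_degree_lt_iff.mp (hg_deg x z h))
        (fun i hi => coeff_leftKLS_eq_zero h hi) ?_
      rw [hg x z h, hrefl x z hxz, ← Finset.sum_Ico_add_eq_sum_Icc hxz,
        ← Finset.sum_Ico_add_eq_sum_Icc hxz, hκ_refl, mul_one, mul_one, add_sub_cancel_right,
        add_sub_cancel_right]
      refine Finset.sum_congr rfl fun y hy => ?_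
      rw [ih y (Finset.mem_Ico.mp hy).2 (Finset.mem_Ico.mp hy).1]
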